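/- Zero violation and regret of OPLB-SP (conditional form of Theorem 2.5). Let K ≥ 1, d ≥ 1, δ ∈ (0,1], ξ > 0, C_p > 0, B > 0, b ∈ ℝ, and C_r = C_p·(1 + 2B/ξ). Let A ⊆ {a ∈ ℝ^d : ‖a‖₂ ≤ 1}, θ_r, θ_u ∈ ℝ^d with ‖θ_r‖₂ ≤ B and ‖θ_u‖₂ ≤ B, and for a probability measure π on A write r_π = ∫⟨θ_r,a⟩dπ and u_π = ∫⟨θ_u,a⟩dπ. Let a^(1),…,a^(K) ∈ A, Λ^(k) = I_d + Σ_{i<k} a^(i)(a^(i))ᵀ, and β^(k)_π = ∫‖a‖_{(Λ^(k))⁻¹} dπ. Let π_sf, π_⋆, π^(1),…,π^(K) be probability measures on A and θ̂_r^(k), θ̂_u^(k) ∈ ℝ^d, with r̂^(k)_π = ∫⟨θ̂_r^(k),a⟩dπ and û^(k)_π = ∫⟨θ̂_u^(k),a⟩dπ. Assume: (i) u_{π_sf} − b ≥ ξ and r_{π_sf} ≥ 0; (ii) u_{π_⋆} ≥ b; (iii) for every k and every probability measure π on A, |r̂^(k)_π − r_π| ≤ C_p·β^(k)_π and |û^(k)_π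 − u_π| ≤ C_p·β^(k)_π; (iv) Σ_{k=1}^K ∫‖a‖²_{(Λ^(k))⁻¹} dπ^(k) ≤ 2·Σ_{k=1}^K ‖a^(k)‖²_{(Λ^(k))⁻¹} + 4·ln(2K/δ); (v) for every k with β^(k)_{π_sf} > ξ/(2C_p), π^(k) = π_sf; and for every k with β^(k)_{π_sf} ≤ ξ/(2C_p), the policy π^(k) satisfies û^(k)_{π^(k)} − C_p·β^(k)_{π^(k)} ≥ b and r̂^(k)_{π^(k)} + C_r·β^(k)_{π^(k)} ≥ r̂^(k)_π + C_r·β^(k)_π for every probability measure π on A with û^(k)_π − C_p·β^(k)_π ≥ b. Then: (a) u_{π^(k)} ≥ b for every k ∈ {1,…,K}; and (b) Σ_{k=1}^K (r_{π_⋆} − r_{π^(k)}) ≤ 64·d·B·C_p²·ξ⁻²·ln(2K/δ) + 4·C_r·√K·√(2d·ln(1+K/d) + 4·ln(2K/δ)). -/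

import Mathlib

open MeasureTheory Matrix Finset

/-- The regularized design matrix `I + ∑_{1 ≤ i < k} a i (a i)ᵀ`. -/
def designMatrix {n : Type*} [DecidableEq n] (a : ℕ → n → ℝ) (k : ℕ) : Matrix n n ℝ :=
  1 + ∑ i ∈ Finset.Ico 1 k, vecMulVec (a i) (a i)

theorem designMatrix_succ {n : Type*} [DecidableEq n] (a : ℕ → n → ℝ) {k : ℕ} (hk : 1 ≤ k) :
    designMatrix a (k + 1) = designMatrix a k + vecMulVec (a k) (a k) := by
  rw [designMatrix, designMatrix, sum_Ico_succ_top hk, add_assoc]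

section LinearAlgebra

variable {n : Type*} [Fintype n]

theorem posSemidef_sum_vecMulVec {ι : Type*} (s : Finset ι) (a : ι → n → ℝ) :
    (∑ i ∈ s, vecMulVec (a i) (a i)).PosSemidef :=
  posSemidef_sum s fun i _ => by simpa using posSemidef_vecMulVec_self_star (a i)

theorem dotProduct_sq_le (x y : n → ℝ) : (x ⬝ᵥ y) ^ 2 ≤ (x ⬝ᵥ x) * (y ⬝ᵥ y) := by
  simpa [dotProduct, sq] using Finset.sum_mul_sq_le_sq_mul_sq univ x y

variable [DecidableEq n]

theorem designMatrix_posDef (a : ℕ → n → ℝ) (k : ℕ) : (designMatrix a k).PosDef :=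
  PosDef.one.add_posSemidef (posSemidef_sum_vecMulVec _ _)

theorem Matrix.PosDef.dotProduct_inv_mulVec_nonneg {M : Matrix n n ℝ} (hM : M.PosDef)
    (x : n → ℝ) : 0 ≤ x ⬝ᵥ M⁻¹.mulVec x := by
  simpa using hM.inv.posSemidef.dotProduct_mulVec_nonneg x

theorem dotProduct_inv_one_add_mulVec_le {M : Matrix n n ℝ} (hM : M.PosSemidef) (x : n → ℝ) :
    x ⬝ᵥ (1 + M)⁻¹.mulVec x ≤ x ⬝ᵥ x := by
  have hP : (1 + M).PosDef := PosDef.one.add_posSemidef hM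
  have h0 := hP.dotProduct_inv_mulVec_nonneg x
  set y := (1 + M)⁻¹.mulVec x with hy
  have hx : x = (1 + M).mulVec y := by
    rw [hy, mulVec_mulVec, mul_nonsing_inv _ ((isUnit_iff_isUnit_det _).1 hP.isUnit), one_mulVec]
  have hyM : 0 ≤ y ⬝ᵥ M.mulVec y := by simpa using hM.dotProduct_mulVec_nonneg y
  have hyy : y ⬝ᵥ y ≤ x ⬝ᵥ y := by
    have : x ⬝ᵥ y = y ⬝ᵥ y + y ⬝ᵥ M.mulVec y := by
      conv_lhs => rw [hx, dotProduct_comm, add_mulVec, one_mulVec, dotProduct_add]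
    linarith
  have hxx : 0 ≤ x ⬝ᵥ x := by simpa using dotProduct_star_self_nonneg x
  have hcs := dotProduct_sq_le x y
  rcases h0.eq_or_lt with h | h
  · rw [← h]; exact hxx
  · nlinarith [mul_le_mul_of_nonneg_left hyy hxx]

theorem dotProduct_designMatrix_inv_mulVec_le (a : ℕ → n → ℝ) (k : ℕ) (x : n → ℝ) :
    x ⬝ᵥ (designMatrix a k)⁻¹.mulVec x ≤ x ⬝ᵥ x :=
  dotProduct_inv_one_add_mulVec_le (posSemidef_sum_vecMulVec _ _) x

theorem det_add_vecMulVec {M : Matrix n n ℝ} (hM : IsUnit M.det) (u v : n → ℝ) :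
    (M + vecMulVec u v).det = M.det * (1 + v ⬝ᵥ M⁻¹.mulVec u) := by
  rw [vecMulVec_eq Unit, det_add_replicateCol_mul_replicateRow hM, det_unique (n := Unit)]
  congr 1
  rw [Matrix.mul_assoc, ← replicateCol_mulVec]
  simp [Matrix.mul_apply, dotProduct]

theorem Matrix.PosDef.log_det_le {M : Matrix n n ℝ} (hM : M.PosDef) {t : ℝ} (ht : 0 < t)
    (htr : M.trace ≤ Fintype.card n * t) :
    Real.log M.det ≤ Fintype.card n * Real.log t := by
  have hpos := hM.eigenvalues_pos
  have htr' : M.trace = ∑ i, hM.isHermitian.eigenvalues i := by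
    simpa using hM.isHermitian.trace_eq_sum_eigenvalues
  have hdet : M.det = ∏ i, hM.isHermitian.eigenvalues i := by
    simpa using hM.isHermitian.det_eq_prod_eigenvalues
  rw [hdet, Real.log_prod fun i _ => (hpos i).ne']
  have h1 : ∀ i ∈ (univ : Finset n), Real.log (hM.isHermitian.eigenvalues i)
      ≤ Real.log t - 1 + hM.isHermitian.eigenvalues i / t := fun i _ => by
    have := Real.log_le_sub_one_of_pos (div_pos (hpos i) ht)
    rw [Real.log_div (hpos i).ne' ht.ne'] at this
    linarith
  refine (sum_le_sum h1).trans ?_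
  rw [sum_add_distrib, ← sum_div, ← htr']
  have : M.trace / t ≤ Fintype.card n := (div_le_iff₀ ht).2 htr
  simp only [sum_const, card_univ, nsmul_eq_mul]
  linarith

theorem le_two_mul_log_one_add {x : ℝ} (h0 : 0 ≤ x) (h1 : x ≤ 1) : x ≤ 2 * Real.log (1 + x) := by
  have h := Real.le_log_one_add_of_nonneg h0
  have h2 : x / 2 ≤ 2 * x / (x + 2) := by
    rw [div_le_div_iff₀ (by norm_num) (by linarith)]
    nlinarith
  linarith

theorem sum_dotProduct_designMatrix_inv_le_log_det (a : ℕ → n → ℝ) (K : ℕ)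
    (ha : ∀ k ∈ Finset.Icc 1 K, a k ⬝ᵥ a k ≤ 1) :
    ∑ k ∈ Finset.Icc 1 K, a k ⬝ᵥ (designMatrix a k)⁻¹.mulVec (a k)
      ≤ 2 * Real.log (designMatrix a (K + 1)).det := by
  induction K with
  | zero => simp [designMatrix]
  | succ K ih =>
    have hP := designMatrix_posDef a (K + 1)
    have h0 := hP.dotProduct_inv_mulVec_nonneg (a (K + 1))
    have h1 := (dotProduct_designMatrix_inv_mulVec_le a (K + 1) (a (K + 1))).trans
      (ha (K + 1) (by simp))
    rw [sum_Icc_succ_top (by lia), designMatrix_succ a (Nat.le_add_left 1 K),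
      det_add_vecMulVec ((isUnit_iff_isUnit_det _).1 hP.isUnit),
      Real.log_mul hP.det_pos.ne' (by linarith)]
    have := ih fun k hk => ha k (Icc_subset_Icc_right K.le_succ hk)
    have := le_two_mul_log_one_add h0 h1
    linarith

theorem trace_designMatrix_succ_le (a : ℕ → n → ℝ) (K : ℕ)
    (ha : ∀ k ∈ Finset.Icc 1 K, a k ⬝ᵥ a k ≤ 1) :
    (designMatrix a (K + 1)).trace ≤ Fintype.card n + K := by
  have : ∑ i ∈ Finset.Icc 1 K, a i ⬝ᵥ a i ≤ K := by
    simpa using sum_le_card_nsmul (Finset.Icc 1 K) (fun i => a i ⬝ᵥ a i) 1 ha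
  simpa [designMatrix, trace_sum, trace_vecMulVec, ← Finset.Ico_add_one_right_eq_Icc] using this

/-- The elliptical potential lemma. -/
theorem sum_dotProduct_designMatrix_inv_le [Nonempty n] (a : ℕ → n → ℝ) (K : ℕ)
    (ha : ∀ k ∈ Finset.Icc 1 K, a k ⬝ᵥ a k ≤ 1) :
    ∑ k ∈ Finset.Icc 1 K, a k ⬝ᵥ (designMatrix a k)⁻¹.mulVec (a k)
      ≤ 2 * (Fintype.card n * Real.log (1 + K / Fintype.card n)) := by
  refine (sum_dotProduct_designMatrix_inv_le_log_det a K ha).trans ?_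
  gcongr
  have hn : (0 : ℝ) < Fintype.card n := by exact_mod_cast Fintype.card_pos
  refine (designMatrix_posDef a (K + 1)).log_det_le (by positivity) ?_
  refine (trace_designMatrix_succ_le a K ha).trans_eq ?_
  field_simp

end LinearAlgebra

section BoundedSupport

variable {n : Type*} [Fintype n] {ρ : Measure (n → ℝ)} {A : Set (n → ℝ)}

theorem isCompact_dotProduct_self_le_one : IsCompact {x : n → ℝ | x ⬝ᵥ x ≤ 1} := by
  refine (isCompact_Icc (a := fun _ : n => (-1 : ℝ)) (b := fun _ => 1)).of_isClosed_subset
    (isClosed_le (by unfold dotProduct; fun_prop) continuous_const) fun x hx => ?_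
  have h : ∀ i, x i * x i ≤ 1 := fun i =>
    (single_le_sum (f := fun i => x i * x i) (fun j _ => mul_self_nonneg _) (mem_univ i)).trans hx
  exact ⟨fun i => by nlinarith [h i], fun i => by nlinarith [h i]⟩

theorem ae_dotProduct_self_le_one [IsProbabilityMeasure ρ] (hA : ∀ x ∈ A, x ⬝ᵥ x ≤ 1)
    (hρ : ρ A = 1) : ∀ᵐ x ∂ρ, x ⬝ᵥ x ≤ 1 := by
  refine (mem_ae_iff_prob_eq_one isCompact_dotProduct_self_le_one.measurableSet).2
    (le_antisymm prob_le_one ?_)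
  rw [← hρ]
  exact measure_mono hA

theorem Continuous.integrable_of_ae_dotProduct_self_le_one [IsFiniteMeasure ρ]
    {f : (n → ℝ) → ℝ} (hf : Continuous f) (hρ : ∀ᵐ x ∂ρ, x ⬝ᵥ x ≤ 1) : Integrable f ρ := by
  have h : IntegrableOn f {x | x ⬝ᵥ x ≤ 1} ρ :=
    hf.continuousOn.integrableOn_compact isCompact_dotProduct_self_le_one
  rwa [IntegrableOn, Measure.restrict_eq_self_of_ae_mem (s := {x | x ⬝ᵥ x ≤ 1}) hρ] at h

theorem abs_integral_dotProduct_le [IsProbabilityMeasure ρ] (hρ : ∀ᵐ x ∂ρ, x ⬝ᵥ x ≤ 1)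
    {θ : n → ℝ} {B : ℝ} (hB : 0 ≤ B) (hθ : θ ⬝ᵥ θ ≤ B ^ 2) : |∫ x, θ ⬝ᵥ x ∂ρ| ≤ B := by
  suffices h : ∀ᵐ x ∂ρ, ‖θ ⬝ᵥ x‖ ≤ B by simpa using norm_integral_le_of_norm_le_const h
  filter_upwards [hρ] with x hx
  refine abs_le_of_sq_le_sq ((dotProduct_sq_le θ x).trans ?_) hB
  have : 0 ≤ x ⬝ᵥ x := by simpa using dotProduct_star_self_nonneg x
  nlinarith [sq_nonneg B]

end BoundedSupport

theorem sq_integral_sqrt_le {α : Type*} [MeasurableSpace α] {ρ : Measure α}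
    [IsProbabilityMeasure ρ] {f : α → ℝ} (hf0 : ∀ x, 0 ≤ f x) (hf : Integrable f ρ)
    (hf' : Integrable (fun x => √(f x)) ρ) :
    (∫ x, √(f x) ∂ρ) ^ 2 ≤ ∫ x, f x ∂ρ := by
  have h := (even_two.convexOn_pow (𝕜 := ℝ)).map_integral_le (continuous_pow 2).continuousOn
    isClosed_univ (by simp) hf' (by simpa [Function.comp_def, Real.sq_sqrt, hf0] using hf)
  simpa [Real.sq_sqrt, hf0] using h

section Mixture

variable {α : Type*} [MeasurableSpace α] (γ : ℝ) (μ ν : Measure α)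

/-- The mixture `γ μ + (1 - γ) ν`. -/
noncomputable def mixture : Measure α := ENNReal.ofReal γ • μ + ENNReal.ofReal (1 - γ) • ν

variable {γ μ ν}

theorem mixture_apply_eq_one (h0 : 0 ≤ γ) (h1 : γ ≤ 1) {s : Set α} (hμ : μ s = 1) (hν : ν s = 1) :
    mixture γ μ ν s = 1 := by
  simp [mixture, hμ, hν, ← ENNReal.ofReal_add h0 (sub_nonneg.2 h1)]

theorem integral_mixture (h0 : 0 ≤ γ) (h1 : γ ≤ 1) {f : α → ℝ} (hμ : Integrable f μ)
    (hν : Integrable f ν) :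
    ∫ x, f x ∂mixture γ μ ν = γ * ∫ x, f x ∂μ + (1 - γ) * ∫ x, f x ∂ν := by
  rw [mixture, integral_add_measure (hμ.smul_measure ENNReal.ofReal_ne_top)
    (hν.smul_measure ENNReal.ofReal_ne_top)]
  simp [integral_smul_measure, h0, h1]

end Mixture

/-- The weight at which mixing into a policy of slack `s` a policy of width `c` uses up exactly
the available slack. -/
theorem exists_weight_mul_eq {c s : ℝ} (hc : 0 ≤ c) (hs : 0 ≤ s) :
    ∃ γ : ℝ, 0 ≤ γ ∧ γ ≤ 1 ∧ γ * c = (1 - γ) * s := by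
  rcases (add_nonneg hc hs).eq_or_lt with h | h
  · exact ⟨1, zero_le_one, le_rfl, by nlinarith⟩
  · refine ⟨s / (c + s), by positivity, (div_le_one h).2 (by linarith), ?_⟩
    field_simp
    ring

/-- If the policy `ν` is confidently safe, then some mixture of `μ` and `ν` is feasible for the
optimistic-pessimistic program and its optimistic value dominates the true reward of `μ`. -/
theorem exists_feasible_optimistic {n : Type*} [Fintype n] {A : Set (n → ℝ)}
    (hA : ∀ x ∈ A, x ⬝ᵥ x ≤ 1) {μ ν : Measure (n → ℝ)} [IsProbabilityMeasure μ]
    [IsProbabilityMeasure ν] (hμA : μ A = 1) (hνA : ν A = 1) {θr θu θr' θu' : n → ℝ}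
    {w : (n → ℝ) → ℝ} (hw : Continuous w) (hw0 : ∀ x, 0 ≤ w x) {ξ C B b : ℝ} (hξ : 0 < ξ)
    (hC : 0 < C)
    (hconf : ∀ ρ : Measure (n → ℝ), IsProbabilityMeasure ρ → ρ A = 1 →
      |(∫ x, θr' ⬝ᵥ x ∂ρ) - ∫ x, θr ⬝ᵥ x ∂ρ| ≤ C * ∫ x, w x ∂ρ ∧
      |(∫ x, θu' ⬝ᵥ x ∂ρ) - ∫ x, θu ⬝ᵥ x ∂ρ| ≤ C * ∫ x, w x ∂ρ)
    (hνu : b + ξ ≤ ∫ x, θu ⬝ᵥ x ∂ν) (hνr : 0 ≤ ∫ x, θr ⬝ᵥ x ∂ν)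
    (hμu : b ≤ ∫ x, θu ⬝ᵥ x ∂μ) (hμr : ∫ x, θr ⬝ᵥ x ∂μ ≤ B)
    (hνw : ∫ x, w x ∂ν ≤ ξ / (2 * C)) :
    ∃ ρ : Measure (n → ℝ), IsProbabilityMeasure ρ ∧ ρ A = 1 ∧
      b ≤ (∫ x, θu' ⬝ᵥ x ∂ρ) - C * ∫ x, w x ∂ρ ∧
      ∫ x, θr ⬝ᵥ x ∂μ ≤ (∫ x, θr' ⬝ᵥ x ∂ρ) + C * (1 + 2 * B / ξ) * ∫ x, w x ∂ρ := by
  have hslack : 0 ≤ ξ - 2 * C * ∫ x, w x ∂ν := by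
    rw [le_div_iff₀ (by positivity)] at hνw
    linarith
  have hwμ : 0 ≤ 2 * C * ∫ x, w x ∂μ := mul_nonneg (by positivity) (integral_nonneg hw0)
  obtain ⟨γ, h0, h1, hγ⟩ := exists_weight_mul_eq hwμ hslack
  have hmix : ∀ {f : (n → ℝ) → ℝ}, Continuous f →
      ∫ x, f x ∂mixture γ μ ν = γ * ∫ x, f x ∂μ + (1 - γ) * ∫ x, f x ∂ν := fun hf =>
    integral_mixture h0 h1
      (hf.integrable_of_ae_dotProduct_self_le_one (ae_dotProduct_self_le_one hA hμA))
      (hf.integrable_of_ae_dotProduct_self_le_one (ae_dotProduct_self_le_one hA hνA))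
  have hlin : ∀ θ : n → ℝ, Continuous fun x => θ ⬝ᵥ x := fun θ => by unfold dotProduct; fun_prop
  have hprob : IsProbabilityMeasure (mixture γ μ ν) :=
    ⟨mixture_apply_eq_one h0 h1 measure_univ measure_univ⟩
  have hmixA := mixture_apply_eq_one h0 h1 hμA hνA
  refine ⟨mixture γ μ ν, hprob, hmixA, ?_, ?_⟩ <;>
    obtain ⟨hr, hu⟩ := hconf _ hprob hmixA
  · have hu := (abs_le.1 hu).1
    rw [hmix (hlin θu)] at hu
    have hwmix := hmix hw
    nlinarith [mul_le_mul_of_nonneg_left hμu h0,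
      mul_le_mul_of_nonneg_left hνu (sub_nonneg.2 h1)]
  · have hr := (abs_le.1 hr).1
    rw [hmix (hlin θr)] at hr
    have hbonus : C * (2 * B / ξ) * ∫ x, w x ∂mixture γ μ ν = (1 - γ) * B := by
      have : 2 * C * ∫ x, w x ∂mixture γ μ ν = (1 - γ) * ξ := by rw [hmix hw]; linarith
      calc _ = B / ξ * (2 * C * ∫ x, w x ∂mixture γ μ ν) := by ring
        _ = _ := by rw [this]; field_simp
    nlinarith [mul_le_mul_of_nonneg_left hμr (sub_nonneg.2 h1),
      mul_nonneg (sub_nonneg.2 h1) hνr]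

theorem sum_sqrt_le_sqrt_card_mul_sqrt_sum {ι : Type*} (s : Finset ι) {f : ι → ℝ}
    (hf : ∀ i ∈ s, 0 ≤ f i) : ∑ i ∈ s, √(f i) ≤ √(#s) * √(∑ i ∈ s, f i) := by
  rw [← Real.sqrt_mul (Nat.cast_nonneg _)]
  refine Real.le_sqrt_of_sq_le (sq_sum_le_card_mul_sum_sq.trans_eq ?_)
  rw [sum_congr rfl fun i hi => Real.sq_sqrt (hf i hi)]

/-- **Zero violation and regret of OPLB-SP (conditional form of Theorem 2.5).**
Under the confidence-bound and elliptical-potential good events and the decision rule of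
Algorithm 1 (deploy the safe policy when unconfident, otherwise solve the
optimistic-pessimistic program), every deployed policy is safe and the regret is bounded by
`64·d·B·C_p²·ξ⁻²·ln(2K/δ) + 4·C_r·√K·√(2d·ln(1+K/d) + 4·ln(2K/δ))`. -/
theorem oplb_sp_zero_violation_and_regret
    (K d : ℕ) (hK : 1 ≤ K) (hd : 1 ≤ d)
    (δ ξ Cp B b Cr : ℝ) (hδ : δ ∈ Set.Ioc (0:ℝ) 1) (hξ : 0 < ξ) (hCp : 0 < Cp) (hB : 0 < B)
    (hCr : Cr = Cp * (1 + 2 * B / ξ))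
    (A : Set (Fin d → ℝ)) (hA : ∀ x ∈ A, Real.sqrt (∑ i, x i ^ 2) ≤ 1)
    (θr θu : Fin d → ℝ)
    (hθr : Real.sqrt (∑ i, θr i ^ 2) ≤ B) (hθu : Real.sqrt (∑ i, θu i ^ 2) ≤ B)
    (a : ℕ → Fin d → ℝ) (ha : ∀ k ∈ Finset.Icc 1 K, a k ∈ A)
    (Λ : ℕ → Matrix (Fin d) (Fin d) ℝ)
    (hΛ : ∀ k, Λ k = 1 + ∑ i ∈ Finset.Ico 1 k, vecMulVec (a i) (a i))
    (πsf πstar : Measure (Fin d → ℝ))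
    [IsProbabilityMeasure πsf] [IsProbabilityMeasure πstar]
    (hπsf_supp : πsf A = 1) (hπstar_supp : πstar A = 1)
    (π : ℕ → Measure (Fin d → ℝ))
    (hπ_prob : ∀ k ∈ Finset.Icc 1 K, IsProbabilityMeasure (π k))
    (hπ_supp : ∀ k ∈ Finset.Icc 1 K, π k A = 1)
    (θrhat θuhat : ℕ → Fin d → ℝ)
    -- (i) the safe policy is strictly feasible and has nonnegative reward
    (h_safe : (∫ x, θu ⬝ᵥ x ∂πsf) - b ≥ ξ) (h_safe_r : (∫ x, θr ⬝ᵥ x ∂πsf) ≥ 0)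
    -- (ii) the optimal policy is feasible
    (h_star : (∫ x, θu ⬝ᵥ x ∂πstar) ≥ b)
    -- (iii) confidence bounds for every round and every policy on A
    (h_conf : ∀ k ∈ Finset.Icc 1 K, ∀ ρ : Measure (Fin d → ℝ),
      IsProbabilityMeasure ρ → ρ A = 1 →
      |(∫ x, θrhat k ⬝ᵥ x ∂ρ) - (∫ x, θr ⬝ᵥ x ∂ρ)|
        ≤ Cp * (∫ x, Real.sqrt (x ⬝ᵥ (Λ k)⁻¹.mulVec x) ∂ρ) ∧
      |(∫ x, θuhat k ⬝ᵥ x ∂ρ) - (∫ x, θu ⬝ᵥ x ∂ρ)|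
        ≤ Cp * (∫ x, Real.sqrt (x ⬝ᵥ (Λ k)⁻¹.mulVec x) ∂ρ))
    -- (iv) elliptical-potential good event
    (h_good : ∑ k ∈ Finset.Icc 1 K, (∫ x, x ⬝ᵥ (Λ k)⁻¹.mulVec x ∂(π k))
      ≤ 2 * ∑ k ∈ Finset.Icc 1 K, (a k ⬝ᵥ (Λ k)⁻¹.mulVec (a k))
        + 4 * Real.log (2 * K / δ))
    -- (v) the decision rule of Algorithm 1
    (h_deploy_safe : ∀ k ∈ Finset.Icc 1 K,
      ξ / (2 * Cp) < (∫ x, Real.sqrt (x ⬝ᵥ (Λ k)⁻¹.mulVec x) ∂πsf) → π k = πsf)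
    (h_optpes : ∀ k ∈ Finset.Icc 1 K,
      (∫ x, Real.sqrt (x ⬝ᵥ (Λ k)⁻¹.mulVec x) ∂πsf) ≤ ξ / (2 * Cp) →
      ((∫ x, θuhat k ⬝ᵥ x ∂(π k))
          - Cp * (∫ x, Real.sqrt (x ⬝ᵥ (Λ k)⁻¹.mulVec x) ∂(π k)) ≥ b ∧
       ∀ ρ : Measure (Fin d → ℝ), IsProbabilityMeasure ρ → ρ A = 1 →
        (∫ x, θuhat k ⬝ᵥ x ∂ρ)
            - Cp * (∫ x, Real.sqrt (x ⬝ᵥ (Λ k)⁻¹.mulVec x) ∂ρ) ≥ b →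
        (∫ x, θrhat k ⬝ᵥ x ∂(π k))
            + Cr * (∫ x, Real.sqrt (x ⬝ᵥ (Λ k)⁻¹.mulVec x) ∂(π k))
          ≥ (∫ x, θrhat k ⬝ᵥ x ∂ρ)
            + Cr * (∫ x, Real.sqrt (x ⬝ᵥ (Λ k)⁻¹.mulVec x) ∂ρ))) :
    (∀ k ∈ Finset.Icc 1 K, (∫ x, θu ⬝ᵥ x ∂(π k)) ≥ b) ∧
    (∑ k ∈ Finset.Icc 1 K, ((∫ x, θr ⬝ᵥ x ∂πstar) - (∫ x, θr ⬝ᵥ x ∂(π k))))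
      ≤ 64 * d * B * Cp ^ 2 * ξ⁻¹ ^ 2 * Real.log (2 * K / δ)
        + 4 * Cr * Real.sqrt K
          * Real.sqrt (2 * d * Real.log (1 + K / d) + 4 * Real.log (2 * K / δ)) := by
  have hsq : ∀ x : Fin d → ℝ, ∑ i, x i ^ 2 = x ⬝ᵥ x := fun x => by simp [dotProduct, sq]
  have hA' : ∀ x ∈ A, x ⬝ᵥ x ≤ 1 := fun x hx => by
    simpa [hsq] using (Real.sqrt_le_left zero_le_one).1 (hA x hx)
  have hθr' : θr ⬝ᵥ θr ≤ B ^ 2 := by simpa [hsq] using (Real.sqrt_le_left hB.le).1 hθr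
  obtain rfl : Λ = designMatrix a := funext hΛ
  have hq0 : ∀ k x, 0 ≤ x ⬝ᵥ (designMatrix a k)⁻¹.mulVec x := fun k =>
    (designMatrix_posDef a k).dotProduct_inv_mulVec_nonneg
  have hq : ∀ k, Continuous fun x : Fin d → ℝ => x ⬝ᵥ (designMatrix a k)⁻¹.mulVec x := fun k => by
    fun_prop
  have hstar_le : ∫ x, θr ⬝ᵥ x ∂πstar ≤ B := (abs_le.1 (abs_integral_dotProduct_le
    (ae_dotProduct_self_le_one hA' hπstar_supp) hB.le hθr')).2
  refine ⟨fun k hk => ?_, ?_⟩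
  · rcases lt_or_ge (ξ / (2 * Cp)) (∫ x, √(x ⬝ᵥ (designMatrix a k)⁻¹.mulVec x) ∂πsf) with h | h
    · rw [h_deploy_safe k hk h]
      linarith
    · have := (abs_le.1 (h_conf k hk _ (hπ_prob k hk) (hπ_supp k hk)).2).2
      linarith [(h_optpes k hk h).1]
  set V : ℕ → ℝ := fun k => ∫ x, x ⬝ᵥ (designMatrix a k)⁻¹.mulVec x ∂(π k) with hV
  have hV0 : ∀ k ∈ Finset.Icc 1 K, 0 ≤ V k := fun k _ => integral_nonneg (hq0 k)
  have hCr0 : 0 ≤ Cr := by rw [hCr]; positivity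
  have hround : ∀ k ∈ Finset.Icc 1 K, (∫ x, θr ⬝ᵥ x ∂πstar) - (∫ x, θr ⬝ᵥ x ∂(π k))
      ≤ 4 * B * Cp ^ 2 * ξ⁻¹ ^ 2 * V k + 2 * Cr * √(V k) := fun k hk => by
    have := hπ_prob k hk
    have hae := ae_dotProduct_self_le_one hA' (hπ_supp k hk)
    have hwV : (∫ x, √(x ⬝ᵥ (designMatrix a k)⁻¹.mulVec x) ∂(π k)) ^ 2 ≤ V k :=
      sq_integral_sqrt_le (hq0 k) ((hq k).integrable_of_ae_dotProduct_self_le_one hae)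
        ((hq k).sqrt.integrable_of_ae_dotProduct_self_le_one hae)
    rcases lt_or_ge (ξ / (2 * Cp)) (∫ x, √(x ⬝ᵥ (designMatrix a k)⁻¹.mulVec x) ∂πsf) with h | h
    · rw [h_deploy_safe k hk h] at hwV ⊢
      have hVlarge : (ξ / (2 * Cp)) ^ 2 ≤ V k := (pow_le_pow_left₀ (by positivity) h.le 2).trans hwV
      have hB_le : B ≤ 4 * B * Cp ^ 2 * ξ⁻¹ ^ 2 * V k := by
        calc B = 4 * B * Cp ^ 2 * ξ⁻¹ ^ 2 * (ξ / (2 * Cp)) ^ 2 := by field_simp; norm_num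
          _ ≤ _ := by gcongr
      have : 0 ≤ 2 * Cr * √(V k) := by positivity
      linarith
    · obtain ⟨ρ, hρ, hρA, hfeas, hopt⟩ := exists_feasible_optimistic hA' hπstar_supp hπsf_supp
        (hq k).sqrt (fun x => Real.sqrt_nonneg _) hξ hCp (h_conf k hk) (by linarith) h_safe_r
        h_star hstar_le h
      have hmax := (h_optpes k hk h).2 ρ hρ hρA hfeas
      rw [← hCr] at hopt
      have hconf := (abs_le.1 (h_conf k hk _ (hπ_prob k hk) (hπ_supp k hk)).1).2
      have hCpCr : Cp ≤ Cr := by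
        rw [hCr]
        exact le_mul_of_one_le_right hCp.le (le_add_of_nonneg_right (by positivity))
      have hw0 : 0 ≤ ∫ x, √(x ⬝ᵥ (designMatrix a k)⁻¹.mulVec x) ∂(π k) :=
        integral_nonneg fun x => Real.sqrt_nonneg _
      have h1 := mul_le_mul_of_nonneg_right hCpCr hw0
      have h2 := mul_le_mul_of_nonneg_left (Real.le_sqrt_of_sq_le hwV) hCr0
      have h3 : 0 ≤ 4 * B * Cp ^ 2 * ξ⁻¹ ^ 2 * V k := mul_nonneg (by positivity) (hV0 k hk)
      linarith
  have : Nonempty (Fin d) := ⟨⟨0, hd⟩⟩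
  have hpot := sum_dotProduct_designMatrix_inv_le a K fun k hk => hA' _ (ha k hk)
  rw [Fintype.card_fin] at hpot
  have hK' : (1 : ℝ) ≤ K := by exact_mod_cast hK
  have hd' : (1 : ℝ) ≤ d := by exact_mod_cast hd
  have h2K : 2 * (K : ℝ) ≤ 2 * K / δ := le_div_self (by positivity) hδ.1 hδ.2
  have hKd : (K : ℝ) / d ≤ K := div_le_self (by positivity) hd'
  have hlog : Real.log (1 + K / d) ≤ Real.log (2 * K / δ) :=
    Real.log_le_log (by positivity) (by linarith)
  have hlog0 : 0 ≤ Real.log (1 + K / d) := Real.log_nonneg (le_add_of_nonneg_right (by positivity))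
  set L₁ := Real.log (1 + K / d)
  set L₂ := Real.log (2 * K / δ)
  have hS : ∑ k ∈ Finset.Icc 1 K, V k ≤ 4 * (d * L₁) + 4 * L₂ := by linarith
  have hdL : d * L₁ ≤ d * L₂ := by gcongr
  have hdL0 : 0 ≤ d * L₁ := by positivity
  have hL₂ : L₂ ≤ d * L₂ := le_mul_of_one_le_left (hlog0.trans hlog) hd'
  calc _ ≤ ∑ k ∈ Finset.Icc 1 K, (4 * B * Cp ^ 2 * ξ⁻¹ ^ 2 * V k + 2 * Cr * √(V k)) :=
        sum_le_sum hround
    _ = 4 * B * Cp ^ 2 * ξ⁻¹ ^ 2 * ∑ k ∈ Finset.Icc 1 K, V k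
        + 2 * Cr * ∑ k ∈ Finset.Icc 1 K, √(V k) := by
      rw [sum_add_distrib, mul_sum, mul_sum]
    _ ≤ 4 * B * Cp ^ 2 * ξ⁻¹ ^ 2 * (16 * (d * L₂))
        + 2 * Cr * (√K * √(2 ^ 2 * (2 * d * L₁ + 4 * L₂))) := by
      have hcs := sum_sqrt_le_sqrt_card_mul_sqrt_sum (Finset.Icc 1 K) hV0
      rw [Nat.card_Icc, Nat.add_sub_cancel] at hcs
      gcongr
      · linarith
      · refine hcs.trans ?_
        gcongr
        linarith
    _ = _ := by
      rw [Real.sqrt_mul (by positivity), Real.sqrt_sq zero_le_two]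
      ring
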